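/- There exist a constant C > 0 and a threshold L₀ ≥ R₀, depending only on R₀, with the following property. Suppose L ≥ L₀, 0 ≤ E ≤ 3 μ 𝔞₀^μ/(L − R₀)³, and m₁ is a Neumann scattering solution with energy E, with Neumann scattering function f_L = m₁(r)/r. Then exp(−√(ζ₀/μ)) ≤ f_L(r) ≤ 1 for all 0 < r ≤ L, and the Dirichlet-Neumann comparison f(r) ≤ f_L(r) ≤ f(r) + C 𝔞₀^μ/L holds for all 0 < r ≤ L, where f is the scattering function of a zero-energy scattering solution. -/

import Mathlib

open Set MeasureTheory

/-- A zero-energy scattering solution `m` for the radial potential `v` supported in `[0, R₀]`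
with semiclassical parameter `μ`: it satisfies `μ m'' = v m` on `(0,∞)`, is continuous on
`[0,∞)` and continuously differentiable on `(0,∞)`, with `m(0) = 0`, `m > 0` on `(0,∞)`, and
`m(r) = r - 𝔞₀^μ` for `r ≥ R₀`, where `𝔞₀^μ := R₀ - m(R₀)` is the scattering length. -/
structure ZeroEnergyScattering (v : ℝ → ℝ) (R₀ μ : ℝ) (m : ℝ → ℝ) : Prop where
  cont : ContinuousOn m (Set.Ici 0)
  diff : ∀ r ∈ Set.Ioi (0 : ℝ), DifferentiableAt ℝ m r
  derivCont : ContinuousOn (deriv m) (Set.Ioi 0)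
  diff2 : ∀ r ∈ Set.Ioi (0 : ℝ), DifferentiableAt ℝ (deriv m) r
  ode : ∀ r ∈ Set.Ioi (0 : ℝ), μ * deriv (deriv m) r = v r * m r
  zero : m 0 = 0
  pos : ∀ r ∈ Set.Ioi (0 : ℝ), 0 < m r
  radiation : ∀ r, R₀ ≤ r → m r = r - (R₀ - m R₀)

/-- A Neumann scattering solution `m₁` with energy `E` on `[0, L]`: it satisfies
`μ m₁'' = (v - E) m₁` on `(0,L)`, is continuous on `[0,L]` and continuously differentiable
on `(0,L]`, with `m₁(0) = 0`, `m₁ > 0` on `(0,L]`, `m₁(L) = L` and `m₁'(L) = 1`.  The Neumann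
scattering function is `f_L(r) = m₁(r)/r`. -/
structure NeumannScattering (v : ℝ → ℝ) (μ L E : ℝ) (m₁ : ℝ → ℝ) : Prop where
  cont : ContinuousOn m₁ (Set.Icc 0 L)
  diff : ∀ r ∈ Set.Ioc (0 : ℝ) L, DifferentiableAt ℝ m₁ r
  derivCont : ContinuousOn (deriv m₁) (Set.Ioc 0 L)
  diff2 : ∀ r ∈ Set.Ioo (0 : ℝ) L, DifferentiableAt ℝ (deriv m₁) r
  ode : ∀ r ∈ Set.Ioo (0 : ℝ) L, μ * deriv (deriv m₁) r = (v r - E) * m₁ r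
  zero : m₁ 0 = 0
  pos : ∀ r ∈ Set.Ioc (0 : ℝ) L, 0 < m₁ r
  bc : m₁ L = L
  bc' : deriv m₁ L = 1

section ScatteringLemmas

open Filter Topology

/-- A function on `[0, c]` vanishing at `0` whose second derivative is at least `-K` satisfies
`u r / r ≤ u c / c + K c / 2`. -/
lemma div_le_of_neg_le_deriv2 {u : ℝ → ℝ} {c K : ℝ} (hc : 0 < c) (hK0 : 0 ≤ K)
    (hu : ContinuousOn u (Icc 0 c)) (hu' : ∀ r ∈ Ioo 0 c, DifferentiableAt ℝ u r)
    (hu'' : ∀ r ∈ Ioo 0 c, DifferentiableAt ℝ (deriv u) r) (h0 : u 0 = 0)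
    (hK : ∀ r ∈ Ioo 0 c, -K ≤ deriv (deriv u) r) {r : ℝ} (hr : 0 < r) (hrc : r ≤ c) :
    u r / r ≤ u c / c + K * c / 2 := by
  have hd : ∀ s ∈ Ioo 0 c, HasDerivAt (fun s ↦ u s + K * s ^ 2 / 2) (deriv u s + K * s) s := by
    intro s hs
    have := (hu' s hs).hasDerivAt.add ((((hasDerivAt_id s).pow 2).const_mul K).div_const 2)
    refine this.congr_deriv ?_
    simp
    ring
  have hd2 : ∀ s ∈ Ioo 0 c, HasDerivAt (fun s ↦ deriv u s + K * s) (deriv (deriv u) s + K) s := by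
    intro s hs
    have := (hu'' s hs).hasDerivAt.add ((hasDerivAt_id s).const_mul K)
    exact this.congr_deriv (by simp)
  have hconv : ConvexOn ℝ (Icc 0 c) (fun s ↦ u s + K * s ^ 2 / 2) := by
    refine convexOn_of_hasDerivWithinAt2_nonneg (f' := fun s ↦ deriv u s + K * s)
      (f'' := fun s ↦ deriv (deriv u) s + K) (convex_Icc 0 c) (hu.add (by fun_prop)) ?_ ?_ ?_
    all_goals rw [interior_Icc]
    · exact fun s hs ↦ (hd s hs).hasDerivWithinAt
    · exact fun s hs ↦ (hd2 s hs).hasDerivWithinAt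
    · intro s hs
      linarith [hK s hs]
  have key := hconv.2 (left_mem_Icc.2 hc.le) (right_mem_Icc.2 hc.le)
    (show 0 ≤ 1 - r / c by rw [sub_nonneg, div_le_one hc]; exact hrc)
    (show 0 ≤ r / c by positivity) (by ring)
  have e : (1 - r / c) • (0 : ℝ) + (r / c) • c = r := by
    simp only [smul_eq_mul]; field_simp; ring
  rw [e] at key
  simp only [smul_eq_mul, h0] at key
  have h1 : u r ≤ r * (u c / c + K * c / 2) - K * r ^ 2 / 2 := by
    have : (r / c) * (u c + K * c ^ 2 / 2) = r * (u c / c + K * c / 2) := by field_simp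
    linarith
  rw [div_le_iff₀ hr]
  have : 0 ≤ K * r ^ 2 / 2 := by positivity
  linarith

/-- A solution of `u'' = q u` on `(0, c]` with `q` bounded and `u` continuous on `[0, c]` has
bounded derivative. -/
lemma exists_abs_deriv_le_of_deriv2_eq_mul {u q : ℝ → ℝ} {c K : ℝ} (hc : 0 < c)
    (hu : ContinuousOn u (Icc 0 c)) (hu'' : ∀ r ∈ Ioc 0 c, DifferentiableAt ℝ (deriv u) r)
    (hode : ∀ r ∈ Ioc 0 c, deriv (deriv u) r = q r * u r) (hq : ∀ r ∈ Ioc 0 c, |q r| ≤ K) :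
    ∃ B, ∀ r ∈ Ioc 0 c, |deriv u r| ≤ B := by
  obtain ⟨M, hM⟩ := isCompact_Icc.exists_bound_of_continuousOn hu
  have hbd : ∀ r ∈ Ioc 0 c, ‖deriv (deriv u) r‖ ≤ K * M := by
    intro r hr
    rw [hode r hr, norm_mul]
    exact mul_le_mul (hq r hr) (hM r (Ioc_subset_Icc_self hr)) (norm_nonneg _)
      ((abs_nonneg _).trans (hq r hr))
  refine ⟨|deriv u c| + K * M * c, fun r hr ↦ ?_⟩
  have h := Convex.norm_image_sub_le_of_norm_deriv_le hu'' hbd (convex_Ioc 0 c)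
    (right_mem_Ioc.2 hc) hr
  simp only [Real.norm_eq_abs] at h
  have h2 : |r - c| ≤ c := by
    rw [abs_le]; constructor <;> linarith [hr.1, hr.2]
  have h3 := mul_le_mul_of_nonneg_left h2 ((norm_nonneg _).trans (hbd r hr))
  have h4 := abs_sub_abs_le_abs_sub (deriv u r) (deriv u c)
  linarith

/-- If `u` vanishes at `0` and `w` is bounded near `0`, then `u * w` tends to `0` at `0⁺`. -/
lemma tendsto_mul_nhdsGT_zero_of_abs_le {u w : ℝ → ℝ} {c B : ℝ} (hc : 0 < c)
    (hu : ContinuousOn u (Icc 0 c)) (h0 : u 0 = 0) (hw : ∀ r ∈ Ioc 0 c, |w r| ≤ B) :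
    Tendsto (fun r ↦ u r * w r) (𝓝[>] 0) (𝓝 0) := by
  have hu0 : Tendsto u (𝓝[>] 0) (𝓝 0) := by
    have h := (hu 0 (left_mem_Icc.2 hc.le)).tendsto
    rw [h0] at h
    refine h.mono_left ?_
    rw [← nhdsWithin_Ioc_eq_nhdsGT hc]
    exact nhdsWithin_mono 0 Ioc_subset_Icc_self
  refine hu0.zero_mul_isBoundedUnder_le ⟨B, ?_⟩
  rw [eventually_map]
  filter_upwards [Ioc_mem_nhdsGT hc] with r hr
  exact hw r hr

/-- A function on `(0, c]` with nonnegative derivative and limit `0` at `0⁺` is nonnegative. -/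
lemma nonneg_of_deriv_nonneg_of_tendsto_zero {F F' : ℝ → ℝ} {c : ℝ}
    (hF : ContinuousOn F (Ioc 0 c)) (hF' : ∀ r ∈ Ioo 0 c, HasDerivAt F (F' r) r)
    (hnn : ∀ r ∈ Ioo 0 c, 0 ≤ F' r) (h0 : Tendsto F (𝓝[>] 0) (𝓝 0)) :
    ∀ r ∈ Ioc 0 c, 0 ≤ F r := by
  have hmono : MonotoneOn F (Ioc 0 c) := by
    refine monotoneOn_of_hasDerivWithinAt_nonneg (f' := F') (convex_Ioc 0 c) hF ?_ ?_
    all_goals rw [interior_Ioc]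
    · exact fun s hs ↦ (hF' s hs).hasDerivWithinAt
    · exact hnn
  intro r hr
  refine le_of_tendsto h0 ?_
  filter_upwards [Ioc_mem_nhdsGT hr.1] with s hs
  exact hmono ⟨hs.1, hs.2.trans hr.2⟩ hr hs.2

/-- A function touching the identity to first order at `L` with second derivative at most
`-κ (s - r)` lies below the identity at `r` by at least `κ (L - r)³ / 3`. -/
lemma le_sub_of_deriv2_le {u : ℝ → ℝ} {r L κ : ℝ} (hrL : r ≤ L)
    (hu : ∀ s ∈ Icc r L, DifferentiableAt ℝ u s) (hu' : ContinuousOn (deriv u) (Icc r L))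
    (hu'' : ∀ s ∈ Ioo r L, DifferentiableAt ℝ (deriv u) s)
    (hκ : ∀ s ∈ Ioo r L, deriv (deriv u) s ≤ -(κ * (s - r))) (hL : u L = L)
    (hL' : deriv u L = 1) : u r ≤ r - κ * (L - r) ^ 3 / 3 := by
  have h1 : AntitoneOn (fun s ↦ deriv u s + κ * (s - r) ^ 2 / 2) (Icc r L) := by
    refine antitoneOn_of_hasDerivWithinAt_nonpos (f' := fun s ↦ deriv (deriv u) s + κ * (s - r))
      (convex_Icc r L) (hu'.add (by fun_prop)) ?_ ?_
    all_goals rw [interior_Icc]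
    · intro s hs
      have := (hu'' s hs).hasDerivAt.add
        (((((hasDerivAt_id s).sub_const r).pow 2).const_mul κ).div_const 2)
      refine (this.congr_deriv ?_).hasDerivWithinAt
      simp
      ring
    · intro s hs
      linarith [hκ s hs]
  have h2 : MonotoneOn
      (fun s ↦ u s - (1 + κ * (L - r) ^ 2 / 2) * (s - r) + κ * (s - r) ^ 3 / 6) (Icc r L) := by
    refine monotoneOn_of_hasDerivWithinAt_nonneg
      (f' := fun s ↦ deriv u s - (1 + κ * (L - r) ^ 2 / 2) + κ * (s - r) ^ 2 / 2)
      (convex_Icc r L) ?_ ?_ ?_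
    · have : ContinuousOn u (Icc r L) := fun s hs ↦ (hu s hs).continuousAt.continuousWithinAt
      fun_prop
    all_goals rw [interior_Icc]
    · intro s hs
      have := ((hu s (Ioo_subset_Icc_self hs)).hasDerivAt.sub
        (((hasDerivAt_id s).sub_const r).const_mul (1 + κ * (L - r) ^ 2 / 2))).add
        (((((hasDerivAt_id s).sub_const r).pow 3).const_mul κ).div_const 6)
      refine (this.congr_deriv ?_).hasDerivWithinAt
      simp
      ring
    · intro s hs
      have := h1 (Ioo_subset_Icc_self hs) (right_mem_Icc.2 hrL) hs.2.le
      simp only [hL'] at this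
      linarith
  have h3 := h2 (left_mem_Icc.2 hrL) (right_mem_Icc.2 hrL) hrL
  simp only [hL, sub_self] at h3
  linarith

namespace ZeroEnergyScattering

variable {v m : ℝ → ℝ} {R₀ μ : ℝ}

lemma deriv2_eq (hm : ZeroEnergyScattering v R₀ μ m) (hμ : 0 < μ) {r : ℝ} (hr : 0 < r) :
    deriv (deriv m) r = v r / μ * m r := by
  have := hm.ode r hr
  field_simp
  linarith

lemma deriv_eq_one (hm : ZeroEnergyScattering v R₀ μ m) (hR₀ : 0 < R₀) {r : ℝ} (hr : R₀ ≤ r) :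
    deriv m r = 1 := by
  have h1 : HasDerivWithinAt m 1 (Ici r) r := by
    refine ((hasDerivWithinAt_id r (Ici r)).sub_const (R₀ - m R₀)).congr ?_ ?_
    · exact fun s hs ↦ hm.radiation s (hr.trans hs)
    · exact hm.radiation r hr
  exact (uniqueDiffWithinAt_Ici r).eq_deriv _
    (hm.diff r (hR₀.trans_le hr)).hasDerivAt.hasDerivWithinAt h1

lemma deriv_le_one (hm : ZeroEnergyScattering v R₀ μ m) (hR₀ : 0 < R₀) (hμ : 0 < μ)
    (hv : ∀ r, 0 ≤ v r) {r : ℝ} (hr : 0 < r) : deriv m r ≤ 1 := by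
  have hmono : MonotoneOn (deriv m) (Ioi 0) := by
    refine monotoneOn_of_deriv_nonneg (convex_Ioi 0) hm.derivCont ?_ ?_
    all_goals rw [interior_Ioi]
    · exact fun s hs ↦ (hm.diff2 s hs).differentiableWithinAt
    · intro s hs
      rw [hm.deriv2_eq hμ hs]
      exact mul_nonneg (div_nonneg (hv s) hμ.le) (hm.pos s hs).le
  rw [← hm.deriv_eq_one hR₀ (r := R₀ + r) (by linarith)]
  exact hmono hr (show 0 < R₀ + r by linarith) (by linarith)

lemma le_self (hm : ZeroEnergyScattering v R₀ μ m) (hR₀ : 0 < R₀) (hμ : 0 < μ)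
    (hv : ∀ r, 0 ≤ v r) {r : ℝ} (hr : 0 ≤ r) : m r ≤ r := by
  have hanti : AntitoneOn (fun s ↦ m s - s) (Ici 0) := by
    refine antitoneOn_of_hasDerivWithinAt_nonpos (f' := fun s ↦ deriv m s - 1) (convex_Ici 0)
      (hm.cont.sub continuousOn_id) ?_ ?_
    all_goals rw [interior_Ici]
    · exact fun s hs ↦ ((hm.diff s hs).hasDerivAt.sub (hasDerivAt_id s)).hasDerivWithinAt
    · exact fun s hs ↦ sub_nonpos.2 (hm.deriv_le_one hR₀ hμ hv hs)
  have := hanti self_mem_Ici hr hr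
  simp only [hm.zero] at this
  linarith

/-- Exponential lower bound on the scattering function in terms of a bound `lam ^ 2` on
`v / μ`. -/
lemma exp_mul_le (hm : ZeroEnergyScattering v R₀ μ m) (hR₀ : 0 < R₀) (hμ : 0 < μ) {lam : ℝ}
    (hlam : 0 ≤ lam) (hvl : ∀ r, v r / μ ≤ lam ^ 2) {r : ℝ} (hr : 0 < r) :
    Real.exp (-(R₀ * lam)) * r ≤ m r := by
  have hE : ∀ c s : ℝ, HasDerivAt (fun s ↦ Real.exp (c * s)) (c * Real.exp (c * s)) s := by
    intro c s
    have := ((hasDerivAt_id s).const_mul c).exp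
    exact this.congr_deriv (by simp [mul_comm])
  have h1 : AntitoneOn (fun s ↦ (deriv m s + lam * m s) * Real.exp (-lam * s)) (Ioi 0) := by
    refine antitoneOn_of_hasDerivWithinAt_nonpos
      (f' := fun s ↦ (v s / μ - lam ^ 2) * m s * Real.exp (-lam * s)) (convex_Ioi 0) ?_ ?_ ?_
    · have := hm.derivCont
      have := hm.cont.mono (Ioi_subset_Ici_self (a := (0 : ℝ)))
      fun_prop
    all_goals rw [interior_Ioi]
    · intro s hs
      have := ((hm.diff2 s hs).hasDerivAt.add ((hm.diff s hs).hasDerivAt.const_mul lam)).mul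
        (hE (-lam) s)
      refine (this.congr_deriv ?_).hasDerivWithinAt
      simp only [hm.deriv2_eq hμ hs, Pi.add_apply]
      ring
    · intro s hs
      exact mul_nonpos_of_nonpos_of_nonneg (mul_nonpos_of_nonpos_of_nonneg
        (sub_nonpos.2 (hvl s)) (hm.pos s hs).le) (Real.exp_pos _).le
  have h2 : ∀ s ∈ Ioc 0 R₀,
      Real.exp (-(R₀ * lam)) * Real.exp (lam * s) ≤ deriv m s + lam * m s := by
    intro s hs
    have h := h1 hs.1 (show R₀ ∈ Ioi (0 : ℝ) from hR₀) hs.2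
    simp only [hm.deriv_eq_one hR₀ le_rfl] at h
    have h3 : Real.exp (-lam * R₀) ≤ (1 + lam * m R₀) * Real.exp (-lam * R₀) :=
      le_mul_of_one_le_left (Real.exp_pos _).le
        (by linarith [mul_nonneg hlam (hm.pos R₀ hR₀).le])
    have h4 := mul_le_mul_of_nonneg_right (h3.trans h) (Real.exp_pos (lam * s)).le
    have h5 : Real.exp (-lam * s) * Real.exp (lam * s) = 1 := by
      rw [← Real.exp_add]; simp
    rw [mul_assoc _ (Real.exp (-lam * s)), h5, mul_one] at h4
    rwa [show -(R₀ * lam) = -lam * R₀ by ring]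
  set p := Real.exp (-(R₀ * lam)) with hp
  have hp0 : 0 < p := Real.exp_pos _
  have hp1 : p ≤ 1 := Real.exp_le_one_iff.2 (by linarith [mul_nonneg hR₀.le hlam])
  have h3 : MonotoneOn (fun s ↦ (m s - p * s) * Real.exp (lam * s)) (Icc 0 R₀) := by
    refine monotoneOn_of_hasDerivWithinAt_nonneg
      (f' := fun s ↦ (deriv m s + lam * m s - p * (lam * s + 1)) * Real.exp (lam * s))
      (convex_Icc 0 R₀) ?_ ?_ ?_
    · have := hm.cont.mono (Icc_subset_Ici_self : Icc 0 R₀ ⊆ Ici 0)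
      fun_prop
    all_goals rw [interior_Icc]
    · intro s hs
      have := ((hm.diff s hs.1).hasDerivAt.sub ((hasDerivAt_id s).const_mul p)).mul (hE lam s)
      refine (this.congr_deriv ?_).hasDerivWithinAt
      simp
      ring
    · intro s hs
      refine mul_nonneg ?_ (Real.exp_pos _).le
      have h4 := mul_le_mul_of_nonneg_left (Real.add_one_le_exp (lam * s)) hp0.le
      linarith [h2 s (Ioo_subset_Ioc_self hs)]
  have h4 : ∀ s ∈ Icc 0 R₀, p * s ≤ m s := by
    intro s hs
    have h := h3 (left_mem_Icc.2 hR₀.le) hs hs.1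
    simp only [hm.zero, mul_zero, sub_zero, zero_mul] at h
    linarith [nonneg_of_mul_nonneg_left h (Real.exp_pos _)]
  rcases le_total r R₀ with hrR | hrR
  · exact h4 r ⟨hr.le, hrR⟩
  · rw [hm.radiation r hrR]
    have h5 := h4 R₀ (right_mem_Icc.2 hR₀.le)
    nlinarith

end ZeroEnergyScattering

namespace NeumannScattering

variable {v m m₁ : ℝ → ℝ} {R₀ μ L E : ℝ}

lemma deriv2_eq (hn : NeumannScattering v μ L E m₁) (hμ : 0 < μ) {r : ℝ} (hr : r ∈ Ioo 0 L) :
    deriv (deriv m₁) r = (v r / μ - E / μ) * m₁ r := by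
  have := hn.ode r hr
  field_simp
  linarith

lemma hasDerivAt_wronskian (hn : NeumannScattering v μ L E m₁)
    (hm : ZeroEnergyScattering v R₀ μ m) (hμ : 0 < μ) {r : ℝ} (hr : r ∈ Ioo 0 L) :
    HasDerivAt (fun s ↦ m₁ s * deriv m s - m s * deriv m₁ s) (E / μ * (m₁ r * m r)) r := by
  have h := ((hn.diff r (Ioo_subset_Ioc_self hr)).hasDerivAt.mul (hm.diff2 r hr.1).hasDerivAt).sub
    ((hm.diff r hr.1).hasDerivAt.mul (hn.diff2 r hr).hasDerivAt)
  refine h.congr_deriv ?_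
  rw [hn.deriv2_eq hμ hr, hm.deriv2_eq hμ hr.1]
  ring

lemma continuousOn_wronskian (hn : NeumannScattering v μ L E m₁)
    (hm : ZeroEnergyScattering v R₀ μ m) :
    ContinuousOn (fun s ↦ m₁ s * deriv m s - m s * deriv m₁ s) (Ioc 0 L) := by
  have h1 := hn.cont.mono (Ioc_subset_Icc_self : Ioc 0 L ⊆ Icc 0 L)
  have h2 := hn.derivCont
  have h3 := hm.cont.mono (fun s hs ↦ hs.1.le : Ioc 0 L ⊆ Ici 0)
  have h4 := hm.derivCont.mono (fun s hs ↦ hs.1 : Ioc 0 L ⊆ Ioi 0)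
  fun_prop

lemma tendsto_wronskian (hn : NeumannScattering v μ L E m₁)
    (hm : ZeroEnergyScattering v R₀ μ m) (hμ : 0 < μ) (hR₀ : 0 < R₀) (hRL : R₀ < L)
    (hv : ∀ r, 0 ≤ v r) (hvb : BddAbove (range v)) (hE : 0 ≤ E) :
    Tendsto (fun s ↦ m₁ s * deriv m s - m s * deriv m₁ s) (𝓝[>] 0) (𝓝 0) := by
  obtain ⟨V, hV⟩ := hvb
  have hV' : ∀ r, v r / μ ≤ V / μ := fun r ↦
    div_le_div_of_nonneg_right (hV (mem_range_self r)) hμ.le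
  have hv0 : ∀ r, 0 ≤ v r / μ := fun r ↦ div_nonneg (hv r) hμ.le
  have hE0 : 0 ≤ E / μ := div_nonneg hE hμ.le
  have hsub : ∀ r ∈ Ioc 0 R₀, r ∈ Ioo 0 L := fun r hr ↦ ⟨hr.1, hr.2.trans_lt hRL⟩
  have hc := hn.cont.mono (Icc_subset_Icc_right hRL.le)
  have hc' := hm.cont.mono (Icc_subset_Ici_self : Icc 0 R₀ ⊆ Ici 0)
  obtain ⟨B, hB⟩ := exists_abs_deriv_le_of_deriv2_eq_mul (K := V / μ) hR₀ hc'
    (fun r hr ↦ hm.diff2 r hr.1) (fun r hr ↦ hm.deriv2_eq hμ hr.1)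
    (fun r _ ↦ by rw [abs_of_nonneg (hv0 r)]; exact hV' r)
  obtain ⟨B₁, hB₁⟩ := exists_abs_deriv_le_of_deriv2_eq_mul (K := V / μ + E / μ) hR₀ hc
    (fun r hr ↦ hn.diff2 r (hsub r hr)) (fun r hr ↦ hn.deriv2_eq hμ (hsub r hr))
    (fun r _ ↦ by rw [abs_le]; constructor <;> linarith [hV' r, hv0 r])
  simpa using (tendsto_mul_nhdsGT_zero_of_abs_le hR₀ hc hn.zero hB).sub
    (tendsto_mul_nhdsGT_zero_of_abs_le hR₀ hc' hm.zero hB₁)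

/-- The Neumann scattering solution dominates the zero-energy scattering solution. -/
lemma zeroEnergy_le (hn : NeumannScattering v μ L E m₁)
    (hm : ZeroEnergyScattering v R₀ μ m) (hμ : 0 < μ) (hR₀ : 0 < R₀) (hRL : R₀ < L)
    (hv : ∀ r, 0 ≤ v r) (hvb : BddAbove (range v)) (hE : 0 ≤ E) {r : ℝ} (hr : r ∈ Ioc 0 L) :
    m r ≤ m₁ r := by
  have hL : L ∈ Ioc 0 L := right_mem_Ioc.2 (hR₀.trans hRL)
  have hW := nonneg_of_deriv_nonneg_of_tendsto_zero (hn.continuousOn_wronskian hm)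
    (fun s hs ↦ hn.hasDerivAt_wronskian hm hμ hs)
    (fun s hs ↦ mul_nonneg (div_nonneg hE hμ.le)
      (mul_nonneg (hn.pos s (Ioo_subset_Ioc_self hs)).le (hm.pos s hs.1).le))
    (hn.tendsto_wronskian hm hμ hR₀ hRL hv hvb hE)
  have hanti : AntitoneOn (fun s ↦ m₁ s / m s) (Ioc 0 L) := by
    have h1 := hn.cont.mono (Ioc_subset_Icc_self : Ioc 0 L ⊆ Icc 0 L)
    have h3 := hm.cont.mono (fun s hs ↦ hs.1.le : Ioc 0 L ⊆ Ici 0)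
    refine antitoneOn_of_hasDerivWithinAt_nonpos
      (f' := fun s ↦ (deriv m₁ s * m s - m₁ s * deriv m s) / m s ^ 2) (convex_Ioc 0 L)
      (h1.div h3 fun s hs ↦ (hm.pos s hs.1).ne') ?_ ?_
    all_goals rw [interior_Ioc]
    · exact fun s hs ↦ ((hn.diff s (Ioo_subset_Ioc_self hs)).hasDerivAt.div
        (hm.diff s hs.1).hasDerivAt (hm.pos s hs.1).ne').hasDerivWithinAt
    · intro s hs
      have := hW s (Ioo_subset_Ioc_self hs)
      exact div_nonpos_of_nonpos_of_nonneg (by linarith) (sq_nonneg _)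
  have h := hanti hr hL hr.2
  have h1 : 1 ≤ m₁ L / m L := by
    rw [hn.bc, one_le_div (hm.pos L hL.1)]
    exact hm.le_self hR₀ hμ hv hL.1.le
  exact (one_le_div (hm.pos r hr.1)).1 (h1.trans h)

/-- If a Neumann scattering solution lies below the identity, its energy is bounded below by the
scattering length. -/
lemma three_mul_scatteringLength_le (hn : NeumannScattering v μ L E m₁)
    (hm : ZeroEnergyScattering v R₀ μ m) (hμ : 0 < μ) (hR₀ : 0 < R₀) (hRL : R₀ < L)
    (hv : ∀ r, 0 ≤ v r) (hvb : BddAbove (range v)) (hE : 0 ≤ E)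
    (hle : ∀ r ∈ Ioc 0 L, m₁ r ≤ r) : 3 * (R₀ - m R₀) ≤ E / μ * L ^ 3 := by
  have hL : L ∈ Ioc 0 L := right_mem_Ioc.2 (hR₀.trans hRL)
  have hE0 : 0 ≤ E / μ := div_nonneg hE hμ.le
  have h := nonneg_of_deriv_nonneg_of_tendsto_zero (c := L)
    (F := fun s ↦ E / μ * s ^ 3 / 3 - (m₁ s * deriv m s - m s * deriv m₁ s))
    (F' := fun s ↦ E / μ * s ^ 2 - E / μ * (m₁ s * m s))
    (ContinuousOn.sub (by fun_prop) (hn.continuousOn_wronskian hm)) ?_ ?_ ?_ L hL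
  · simp only [hn.bc, hn.bc', hm.deriv_eq_one hR₀ hRL.le, hm.radiation L hRL.le] at h
    linarith
  · intro s hs
    have h1 := ((((hasDerivAt_id s).pow 3).const_mul (E / μ)).div_const 3).sub
      (hn.hasDerivAt_wronskian hm hμ hs)
    refine h1.congr_deriv ?_
    simp
    ring
  · intro s hs
    have h1 : m₁ s * m s ≤ s * s :=
      mul_le_mul (hle s (Ioo_subset_Ioc_self hs)) (hm.le_self hR₀ hμ hv hs.1.le)
        (hm.pos s hs.1).le hs.1.le
    have h2 := mul_le_mul_of_nonneg_left h1 hE0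
    linarith
  · have h1 : Tendsto (fun s : ℝ ↦ E / μ * s ^ 3 / 3) (𝓝[>] 0) (𝓝 0) := by
      have : ContinuousAt (fun s : ℝ ↦ E / μ * s ^ 3 / 3) 0 := by fun_prop
      simpa using this.tendsto.mono_left nhdsWithin_le_nhds
    simpa using h1.sub (hn.tendsto_wronskian hm hμ hR₀ hRL hv hvb hE)

/-- Outside the support of the potential, `m₁ r ≤ r - (E / μ) (L - r)³ / 3`. -/
lemma le_sub_of_radius_le (hn : NeumannScattering v μ L E m₁)
    (hm : ZeroEnergyScattering v R₀ μ m) (hμ : 0 < μ) (hR₀ : 0 < R₀) (hRL : R₀ < L)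
    (hv : ∀ r, 0 ≤ v r) (hvb : BddAbove (range v)) (hv0 : ∀ r, R₀ ≤ r → v r = 0) (hE : 0 ≤ E)
    {r : ℝ} (hr : R₀ ≤ r) (hrL : r ≤ L) : m₁ r ≤ r - E / μ * (L - r) ^ 3 / 3 := by
  have hsub : Icc r L ⊆ Ioc 0 L := fun s hs ↦ ⟨(hR₀.trans_le hr).trans_le hs.1, hs.2⟩
  have hsub' : Ioo r L ⊆ Ioo 0 L := fun s hs ↦ ⟨(hR₀.trans_le hr).trans hs.1, hs.2⟩
  refine le_sub_of_deriv2_le hrL (fun s hs ↦ hn.diff s (hsub hs)) (hn.derivCont.mono hsub)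
    (fun s hs ↦ hn.diff2 s (hsub' hs)) (fun s hs ↦ ?_) hn.bc hn.bc'
  rw [hn.deriv2_eq hμ (hsub' hs), hv0 s (hr.trans hs.1.le)]
  have h1 := hn.zeroEnergy_le hm hμ hR₀ hRL hv hvb hE (Ioo_subset_Ioc_self (hsub' hs))
  have h2 : s - r ≤ m₁ s := by
    rw [hm.radiation s (hr.trans hs.1.le)] at h1
    linarith [hm.pos R₀ hR₀]
  have h3 := mul_le_mul_of_nonneg_left h2 (div_nonneg hE hμ.le)
  simp only [zero_div, zero_sub, neg_mul]
  linarith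

/-- Inside the support of the potential, if `E R₀² ≤ μ`, then
`m₁ r / r ≤ (1 + E R₀² / μ) m₁ R₀ / R₀`. -/
lemma div_le_of_le_radius (hn : NeumannScattering v μ L E m₁) (hμ : 0 < μ) (hR₀ : 0 < R₀)
    (hRL : R₀ < L) (hv : ∀ r, 0 ≤ v r) (hE : 0 ≤ E) (hsmall : E / μ * R₀ ^ 2 ≤ 1) {r : ℝ}
    (hr : 0 < r) (hrR : r ≤ R₀) : m₁ r / r ≤ (1 + E / μ * R₀ ^ 2) * (m₁ R₀ / R₀) := by
  have hE0 : 0 ≤ E / μ := div_nonneg hE hμ.le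
  have hc := hn.cont.mono (Icc_subset_Icc_right hRL.le)
  have hsub : Ioo 0 R₀ ⊆ Ioo 0 L := Ioo_subset_Ioo_right hRL.le
  have hpR := hn.pos R₀ ⟨hR₀, hRL.le⟩
  obtain ⟨x, hx, hmax⟩ := isCompact_Icc.exists_isMaxOn (nonempty_Icc.2 hR₀.le) hc
  have hB : ∀ s ∈ Icc 0 R₀, m₁ s ≤ m₁ x := fun s hs ↦ hmax hs
  have hRx := hB R₀ (right_mem_Icc.2 hR₀.le)
  have hx0 : 0 < x := by
    rcases hx.1.eq_or_lt with h | h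
    · rw [← h, hn.zero] at hRx
      linarith
    · exact h
  have key : ∀ s, 0 < s → s ≤ R₀ → m₁ s / s ≤ m₁ R₀ / R₀ + E / μ * m₁ x * R₀ / 2 := by
    intro s hs hsR
    refine div_le_of_neg_le_deriv2 hR₀ (mul_nonneg hE0 (hpR.le.trans hRx)) hc
      (fun t ht ↦ hn.diff t (Ioo_subset_Ioc_self (hsub ht))) (fun t ht ↦ hn.diff2 t (hsub ht))
      hn.zero (fun t ht ↦ ?_) hs hsR
    rw [hn.deriv2_eq hμ (hsub ht), sub_mul]
    have h1 := mul_nonneg (div_nonneg (hv t) hμ.le) (hn.pos t (Ioo_subset_Ioc_self (hsub ht))).le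
    have h2 := mul_le_mul_of_nonneg_left (hB t (Ioo_subset_Icc_self ht)) hE0
    linarith
  have hx2 : m₁ x ≤ 2 * m₁ R₀ := by
    have h1 := key x hx0 hx.2
    rw [div_le_iff₀ hx0] at h1
    have h2 : (m₁ R₀ / R₀ + E / μ * m₁ x * R₀ / 2) * x ≤
        (m₁ R₀ / R₀ + E / μ * m₁ x * R₀ / 2) * R₀ := by
      have := hpR.le.trans hRx
      exact mul_le_mul_of_nonneg_left hx.2 (by positivity)
    have h3 : (m₁ R₀ / R₀ + E / μ * m₁ x * R₀ / 2) * R₀ =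
        m₁ R₀ + (E / μ * R₀ ^ 2) * m₁ x / 2 := by field_simp
    have h4 := mul_le_mul_of_nonneg_right hsmall (hpR.le.trans hRx)
    linarith
  refine (key r hr hrR).trans ?_
  have h1 := mul_le_mul_of_nonneg_left hx2 (mul_nonneg hE0 hR₀.le)
  have h2 : (1 + E / μ * R₀ ^ 2) * (m₁ R₀ / R₀) = m₁ R₀ / R₀ + E / μ * R₀ * m₁ R₀ := by
    field_simp
  linarith

/-- A Neumann scattering solution of small energy lies below the identity. -/
lemma le_self (hn : NeumannScattering v μ L E m₁)
    (hm : ZeroEnergyScattering v R₀ μ m) (hμ : 0 < μ) (hR₀ : 0 < R₀) (hRL : 3 * R₀ ≤ L)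
    (hv : ∀ r, 0 ≤ v r) (hvb : BddAbove (range v)) (hv0 : ∀ r, R₀ ≤ r → v r = 0) (hE : 0 ≤ E)
    (hsmall : E / μ * R₀ ^ 2 ≤ 1) {r : ℝ} (hr : r ∈ Ioc 0 L) : m₁ r ≤ r := by
  have hE0 : 0 ≤ E / μ := div_nonneg hE hμ.le
  have hRL' : R₀ < L := by linarith
  rcases le_total R₀ r with hrR | hrR
  · have h1 := hn.le_sub_of_radius_le hm hμ hR₀ hRL' hv hvb hv0 hE hrR hr.2
    have h2 : 0 ≤ E / μ * (L - r) ^ 3 / 3 := by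
      have := sub_nonneg.2 hr.2
      positivity
    linarith
  · have h1 := hn.le_sub_of_radius_le hm hμ hR₀ hRL' hv hvb hv0 hE le_rfl hRL'.le
    have h2 := hn.div_le_of_le_radius hμ hR₀ hRL' hv hE hsmall hr.1 hrR
    have h3 : (2 * R₀) ^ 3 ≤ (L - R₀) ^ 3 :=
      pow_le_pow_left₀ (by linarith) (by linarith) 3
    have h4 : m₁ R₀ / R₀ ≤ 1 - E / μ * R₀ ^ 2 := by
      rw [div_le_iff₀ hR₀]
      have h5 := mul_le_mul_of_nonneg_left h3 hE0
      have h6 : 0 ≤ E / μ * R₀ ^ 3 := by positivity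
      linarith
    rw [← div_le_one hr.1]
    have h7 : 0 ≤ E / μ * R₀ ^ 2 := by positivity
    have h8 := mul_le_mul_of_nonneg_left h4 (by linarith : 0 ≤ 1 + E / μ * R₀ ^ 2)
    nlinarith [sq_nonneg (E / μ * R₀ ^ 2)]

/-- Outside the support of the potential, the Neumann and zero-energy scattering functions differ
by at most `3 (R₀ - m R₀) / L`. -/
lemma div_le_add_of_radius_le (hn : NeumannScattering v μ L E m₁)
    (hm : ZeroEnergyScattering v R₀ μ m) (hμ : 0 < μ) (hR₀ : 0 < R₀) (hRL : R₀ < L)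
    (hv : ∀ r, 0 ≤ v r) (hvb : BddAbove (range v)) (hv0 : ∀ r, R₀ ≤ r → v r = 0) (hE : 0 ≤ E)
    (hle : ∀ r ∈ Ioc 0 L, m₁ r ≤ r) {r : ℝ} (hr : R₀ ≤ r) (hrL : r ≤ L) :
    (m₁ r - m r) / r ≤ 3 * (R₀ - m R₀) / L := by
  have hr0 : 0 < r := hR₀.trans_le hr
  have hL : 0 < L := hR₀.trans hRL
  have h1 := hn.le_sub_of_radius_le hm hμ hR₀ hRL hv hvb hv0 hE hr hrL
  have h2 := hn.three_mul_scatteringLength_le hm hμ hR₀ hRL hv hvb hE hle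
  have ha : 0 ≤ R₀ - m R₀ := sub_nonneg.2 (hm.le_self hR₀ hμ hv hR₀.le)
  rw [hm.radiation r hr]
  set a := R₀ - m R₀
  have h3 : 3 * a / L ^ 3 ≤ E / μ := (div_le_iff₀ (by positivity)).2 h2
  have h4 := mul_le_mul_of_nonneg_right h3 (pow_nonneg (sub_nonneg.2 hrL) 3)
  have h5 : a - 3 * a / L ^ 3 * (L - r) ^ 3 / 3 ≤ 3 * a / L * r := by
    have e : 3 * a / L * r - (a - 3 * a / L ^ 3 * (L - r) ^ 3 / 3) =
        a * (r ^ 2 * (3 * L - r)) / L ^ 3 := by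
      field_simp
      ring
    have : 0 ≤ 3 * L - r := by linarith
    have : 0 ≤ a * (r ^ 2 * (3 * L - r)) / L ^ 3 := by positivity
    linarith
  rw [div_le_iff₀ hr0]
  linarith

/-- Inside the support of the potential, the difference of the Neumann and zero-energy scattering
functions is controlled by its value at the boundary of the support. -/
lemma div_le_add_of_le_radius (hn : NeumannScattering v μ L E m₁)
    (hm : ZeroEnergyScattering v R₀ μ m) (hμ : 0 < μ) (hR₀ : 0 < R₀) (hRL : R₀ < L)
    (hv : ∀ r, 0 ≤ v r) (hvb : BddAbove (range v)) (hE : 0 ≤ E)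
    (hle : ∀ r ∈ Ioc 0 L, m₁ r ≤ r) {r : ℝ} (hr : 0 < r) (hrR : r ≤ R₀) :
    (m₁ r - m r) / r ≤ (m₁ R₀ - m R₀) / R₀ + E / μ * R₀ * R₀ / 2 := by
  have hE0 : 0 ≤ E / μ := div_nonneg hE hμ.le
  have hsub : Ioo 0 R₀ ⊆ Ioo 0 L := Ioo_subset_Ioo_right hRL.le
  have hd : ∀ s ∈ Ioo 0 L, deriv (fun s ↦ m₁ s - m s) s = deriv m₁ s - deriv m s :=
    fun s hs ↦ deriv_fun_sub (hn.diff s (Ioo_subset_Ioc_self hs)) (hm.diff s hs.1)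
  have hd' : ∀ s ∈ Ioo 0 L,
      deriv (fun s ↦ m₁ s - m s) =ᶠ[𝓝 s] fun s ↦ deriv m₁ s - deriv m s := by
    intro s hs
    filter_upwards [isOpen_Ioo.mem_nhds hs] with t ht using hd t ht
  refine div_le_of_neg_le_deriv2 (u := fun s ↦ m₁ s - m s) hR₀ (mul_nonneg hE0 hR₀.le)
    ((hn.cont.mono (Icc_subset_Icc_right hRL.le)).sub
      (hm.cont.mono (Icc_subset_Ici_self : Icc 0 R₀ ⊆ Ici 0)))
    (fun s hs ↦ (hn.diff s (Ioo_subset_Ioc_self (hsub hs))).sub (hm.diff s hs.1))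
    (fun s hs ↦ ((hn.diff2 s (hsub hs)).fun_sub (hm.diff2 s hs.1)).congr_of_eventuallyEq
      (hd' s (hsub hs)))
    (by simp [hn.zero, hm.zero]) (fun s hs ↦ ?_) hr hrR
  have hs' := hsub hs
  rw [(hd' s hs').deriv_eq, deriv_fun_sub (hn.diff2 s hs') (hm.diff2 s hs.1),
    hn.deriv2_eq hμ hs', hm.deriv2_eq hμ hs.1]
  have h1 := hn.zeroEnergy_le hm hμ hR₀ hRL hv hvb hE (Ioo_subset_Ioc_self hs')
  have h2 := mul_nonneg (div_nonneg (hv s) hμ.le) (sub_nonneg.2 h1)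
  have h3 := mul_le_mul_of_nonneg_left
    ((hle s (Ioo_subset_Ioc_self hs')).trans hs.2.le) hE0
  linarith

end NeumannScattering

end ScatteringLemmas

/-- **Dirichlet–Neumann comparison.**  There exist `C > 0` and a threshold `L₀ ≥ R₀`,
depending only on `R₀`, such that whenever `L ≥ L₀`, `0 ≤ E ≤ 3μ𝔞₀^μ/(L-R₀)³` and `m₁` is a
Neumann scattering solution with energy `E`, its Neumann scattering function
`f_L(r) = m₁(r)/r` satisfies `exp(-√(ζ₀/μ)) ≤ f_L(r) ≤ 1` and
`f(r) ≤ f_L(r) ≤ f(r) + C 𝔞₀^μ/L` for all `0 < r ≤ L`, where `f = m/r` is the scattering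
function of a zero-energy scattering solution `m`. -/
theorem neumann_dirichlet_comparison
    (R₀ : ℝ) (hR₀ : 0 < R₀) :
    ∃ C > (0 : ℝ), ∃ L₀ ≥ R₀,
      ∀ μ : ℝ, 0 < μ →
      ∀ v : ℝ → ℝ, Measurable v → (∀ r, 0 ≤ v r) → BddAbove (Set.range v) →
        (∀ r, R₀ ≤ r → v r = 0) →
      ∀ m : ℝ → ℝ, ZeroEnergyScattering v R₀ μ m →
      ∀ L E : ℝ, L₀ ≤ L → 0 ≤ E → E ≤ 3 * μ * (R₀ - m R₀) / (L - R₀) ^ 3 →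
      ∀ m₁ : ℝ → ℝ, NeumannScattering v μ L E m₁ →
      ∀ r, 0 < r → r ≤ L →
        (Real.exp (-Real.sqrt (R₀ ^ 2 * (⨆ r', v r') / μ)) ≤ m₁ r / r ∧ m₁ r / r ≤ 1) ∧
        (m r / r ≤ m₁ r / r ∧ m₁ r / r ≤ m r / r + C * (R₀ - m R₀) / L) := by
  refine ⟨4, by norm_num, 3 * R₀, by linarith, ?_⟩
  intro μ hμ v _ hv hvb hv0 m hm L E hL hE hEle m₁ hn r hr hrL
  have hRL : R₀ < L := by linarith
  have hE0 : 0 ≤ E / μ := div_nonneg hE hμ.le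
  have hL0 : 0 < L := by linarith
  have ha : 0 ≤ R₀ - m R₀ := sub_nonneg.2 (hm.le_self hR₀ hμ hv hR₀.le)
  have haR : R₀ - m R₀ ≤ R₀ := by linarith [hm.pos R₀ hR₀]
  have hκ : E / μ ≤ 3 * (R₀ - m R₀) / (L - R₀) ^ 3 := by
    rw [div_le_iff₀ hμ]
    exact hEle.trans_eq (by ring)
  have hLR : (2 / 3 * L) ^ 3 ≤ (L - R₀) ^ 3 :=
    pow_le_pow_left₀ (by linarith) (by linarith) 3
  have hκL : E / μ * R₀ ^ 2 ≤ 9 / 8 * (R₀ - m R₀) / L := by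
    have h1 : E / μ ≤ 3 * (R₀ - m R₀) / (2 / 3 * L) ^ 3 :=
      hκ.trans (div_le_div_of_nonneg_left (by linarith) (by positivity) hLR)
    have h2 : R₀ ^ 2 ≤ (L / 3) ^ 2 := pow_le_pow_left₀ hR₀.le (by linarith) 2
    have h3 := mul_le_mul h1 h2 (sq_nonneg _) (hE0.trans h1)
    exact h3.trans_eq (by field_simp; ring)
  have hsmall : E / μ * R₀ ^ 2 ≤ 1 := by
    refine hκL.trans ((div_le_one hL0).2 ?_)
    linarith
  have hle : ∀ s ∈ Ioc 0 L, m₁ s ≤ s :=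
    fun s hs ↦ hn.le_self hm hμ hR₀ hL hv hvb hv0 hE hsmall hs
  have hge := hn.zeroEnergy_le hm hμ hR₀ hRL hv hvb hE ⟨hr, hrL⟩
  have hfge : m r / r ≤ m₁ r / r := div_le_div_of_nonneg_right hge hr.le
  have hS : ∀ s, v s / μ ≤ Real.sqrt ((⨆ r', v r') / μ) ^ 2 := by
    intro s
    have h1 : v s / μ ≤ (⨆ r', v r') / μ := div_le_div_of_nonneg_right (le_ciSup hvb s) hμ.le
    rwa [Real.sq_sqrt ((div_nonneg (hv s) hμ.le).trans h1)]
  refine ⟨⟨?_, (div_le_one hr).2 (hle r ⟨hr, hrL⟩)⟩, hfge, ?_⟩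
  · refine le_trans ?_ hfge
    rw [le_div_iff₀ hr, mul_div_assoc, Real.sqrt_mul (sq_nonneg _), Real.sqrt_sq hR₀.le]
    exact hm.exp_mul_le hR₀ hμ (Real.sqrt_nonneg _) hS hr
  · have hmain : (m₁ r - m r) / r ≤ 4 * (R₀ - m R₀) / L := by
      have h3 : 3 * (R₀ - m R₀) / L + 9 / 8 * (R₀ - m R₀) / L / 2 ≤ 4 * (R₀ - m R₀) / L := by
        have : 0 ≤ (R₀ - m R₀) / L := div_nonneg ha hL0.le
        simp only [mul_div_assoc] at this ⊢
        linarith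
      have h4 : 0 ≤ E / μ * R₀ ^ 2 := by positivity
      rcases le_total R₀ r with hrR | hrR
      · have := hn.div_le_add_of_radius_le hm hμ hR₀ hRL hv hvb hv0 hE hle hrR hrL
        linarith
      · have h1 := hn.div_le_add_of_le_radius hm hμ hR₀ hRL hv hvb hE hle hr hrR
        have h2 := hn.div_le_add_of_radius_le hm hμ hR₀ hRL hv hvb hv0 hE hle le_rfl hRL.le
        linarith
    rw [sub_div] at hmain
    linarith
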